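/- Let E be a Polish space with Borel σ-field 𝓔, let μ₁ and μ₂ be invariant probability measures of a Markov kernel P on E, and let ρ : E × E → [0, ∞) be lower semi-continuous and positive definite (ρ(x,y) = 0 iff x = y). Assume there exists M ∈ 𝓔 ⊗ 𝓔 with (μ₁ ⊗ μ₂)(M) > 0 such that for every (x, y) ∈ M there exists α_{x,y} > 0 such that for every ε > 0 there exists a generalized coupling ξ^ε_{x,y} ∈ Ĉ(ℙ_x, ℙ_y) satisfying ξ^ε_{x,y}( { (ξ, η) ∈ E^{ℕ₀} × E^{ℕ₀} : limsup_{n→∞} (1/n) ∑_{i=0}^{n−1} 𝟙_{[0,ε]}(ρ(ξ_i, η_i)) ≥ α_{x,y} } ) > 0. Then μ₁ and μ₂ are not mutually singular. -/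

import Mathlib

open MeasureTheory ProbabilityTheory Filter

/-- `μ` is an invariant probability measure of the Markov kernel `P`. -/
def IsInvariantMeasure {E : Type*} [MeasurableSpace E] (P : Kernel E E)
    (μ : Measure E) : Prop :=
  ∀ A : Set E, MeasurableSet A → μ A = ∫⁻ x, P x A ∂μ

/-- Prepend a point to a trajectory. -/
def consTraj {E : Type*} (x : E) (ω : ℕ → E) : ℕ → E :=
  fun n => Nat.casesOn n x ω

/-- `ℙP : E → Measure (ℕ → E)` is the family of laws of the Markov chain with
kernel `P`. -/
def IsChainLaw {E : Type*} [MeasurableSpace E] (P : Kernel E E)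
    (ℙP : E → Measure (ℕ → E)) : Prop :=
  (∀ x, IsProbabilityMeasure (ℙP x)) ∧
    ∀ x, ℙP x = (P x).bind (fun y => (ℙP y).map (consTraj x))

/-- `ξ` is a generalized coupling of `ℙx` and `ℙy`. -/
def IsGeneralizedCoupling {E : Type*} [MeasurableSpace E]
    (ξ : Measure ((ℕ → E) × (ℕ → E))) (ℙx ℙy : Measure (ℕ → E)) : Prop :=
  IsProbabilityMeasure ξ ∧ ξ.map Prod.fst ≪ ℙx ∧ ξ.map Prod.snd ≪ ℙy

section Helpers

open Set

variable {E : Type*} [MeasurableSpace E]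

lemma measurable_consTraj_aux (x : E) : Measurable (consTraj x) := by
  rw [measurable_pi_iff]
  intro n
  cases n with
  | zero => exact measurable_const
  | succ n => exact measurable_pi_apply n

/-- the shift on trajectories -/
def shiftTraj (ω : ℕ → E) : ℕ → E := fun n => ω (n + 1)

lemma measurable_shiftTraj : Measurable (shiftTraj (E := E)) := by
  rw [measurable_pi_iff]
  intro n
  exact measurable_pi_apply (n + 1)

lemma chain_aemeasurable {P : Kernel E E} {ℙP : E → Measure (ℕ → E)} (hℙ : IsChainLaw P ℙP)
    (x : E) : AEMeasurable (fun y => (ℙP y).map (consTraj x)) (P x) := by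
  by_contra h
  have h1 := hℙ.2 x
  have := hℙ.1 x
  rw [Measure.bind, Measure.map_of_not_aemeasurable h, Measure.join_zero] at h1
  exact IsProbabilityMeasure.ne_zero _ h1

lemma chain_rec {P : Kernel E E} {ℙP : E → Measure (ℕ → E)} (hℙ : IsChainLaw P ℙP)
    (x : E) {B : Set (ℕ → E)} (hB : MeasurableSet B) :
    ℙP x B = ∫⁻ y, ℙP y (consTraj x ⁻¹' B) ∂(P x) := by
  conv_lhs => rw [hℙ.2 x, Measure.bind_apply hB (chain_aemeasurable hℙ x)]
  simp_rw [Measure.map_apply (measurable_consTraj_aux x) hB]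

lemma chain_lintegral {P : Kernel E E} {ℙP : E → Measure (ℕ → E)} (hℙ : IsChainLaw P ℙP)
    (x : E) {f : (ℕ → E) → ENNReal} (hf : Measurable f) :
    ∫⁻ ω, f ω ∂(ℙP x) = ∫⁻ y, ∫⁻ ω, f (consTraj x ω) ∂(ℙP y) ∂(P x) := by
  conv_lhs => rw [hℙ.2 x, Measure.lintegral_bind (chain_aemeasurable hℙ x) hf.aemeasurable]
  simp_rw [lintegral_map hf (measurable_consTraj_aux x)]

lemma chain_measurable_pi {P : Kernel E E} {ℙP : E → Measure (ℕ → E)} (hℙ : IsChainLaw P ℙP)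
    (n : ℕ) : ∀ A : ℕ → Set E, (∀ i, MeasurableSet (A i)) → (∀ i, n ≤ i → A i = univ) →
      Measurable (fun x => ℙP x (Set.pi univ A)) := by
  induction n with
  | zero =>
    intro A _ hu
    have : Set.pi univ A = univ := by ext; simp [hu]
    rw [this]
    have : (fun x => ℙP x univ) = fun _ => 1 := by
      funext x
      have := hℙ.1 x
      simp
    rw [this]
    exact measurable_const
  | succ n ih =>
    intro A hA hu
    have key : (fun x => ℙP x (Set.pi univ A)) =
        (A 0).indicator (fun x => ∫⁻ y, ℙP y (Set.pi univ (fun i => A (i + 1))) ∂(P x)) := by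
      funext x
      rw [chain_rec hℙ x (MeasurableSet.univ_pi hA)]
      by_cases hx : x ∈ A 0
      · rw [indicator_of_mem hx]
        congr 1
        funext y
        congr 1
        ext ω
        simp only [mem_preimage, mem_univ_pi]
        constructor
        · intro h i
          exact h (i + 1)
        · intro h i
          cases i with
          | zero => exact hx
          | succ i => exact h i
      · rw [indicator_of_notMem hx]
        have : consTraj x ⁻¹' (Set.pi univ A) = ∅ := by
          ext ω
          simp only [mem_preimage, mem_univ_pi, mem_empty_iff_false, iff_false]
          intro h
          exact hx (h 0)
        simp [this]
    rw [key]
    refine Measurable.indicator ?_ (hA 0)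
    exact Measurable.lintegral_kernel
      (ih _ (fun i => hA (i + 1)) (fun i hi => hu (i + 1) (by omega)))

lemma chain_measurable {P : Kernel E E} {ℙP : E → Measure (ℕ → E)} (hℙ : IsChainLaw P ℙP) :
    Measurable ℙP := by
  have := hℙ.1
  refine Measurable.measure_of_isPiSystem_of_isProbabilityMeasure
    (S := squareCylinders (fun _ : ℕ => {s : Set E | MeasurableSet s})) ?_ ?_ ?_
  · exact generateFrom_squareCylinders.symm
  · exact isPiSystem_squareCylinders (fun _ ↦ MeasurableSpace.isPiSystem_measurableSet) (by simp)
  · rintro B ⟨s, S, hS, rfl⟩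
    classical
    have hS' : ∀ i, MeasurableSet (S i) := fun i => by
      exact hS i (mem_univ i)
    have : (Set.pi (↑s) S : Set (ℕ → E)) = Set.pi univ (fun i => if i ∈ s then S i else univ) := by
      ext ω
      simp only [Set.mem_pi, mem_univ, true_implies]
      refine forall_congr' fun i => ?_
      by_cases h : i ∈ s <;> simp [h]
    rw [this]
    refine chain_measurable_pi hℙ (s.sup id + 1) _ ?_ ?_
    · intro i
      split_ifs
      · exact hS' i
      · exact MeasurableSet.univ
    · intro i hi
      rw [if_neg]
      intro h
      have : i ≤ s.sup id := Finset.le_sup (f := id) h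
      omega

lemma chain_markov {P : Kernel E E} [IsMarkovKernel P] {ℙP : E → Measure (ℕ → E)}
    (hℙ : IsChainLaw P ℙP) {A : Set (ℕ → E)} (hA : MeasurableSet A)
    (hinv : ∀ x ω, consTraj x ω ∈ A ↔ ω ∈ A) (n : ℕ) :
    ∀ B : Set (ℕ → E), MeasurableSet B →
      (∀ ω ω', (∀ i ≤ n, ω i = ω' i) → (ω ∈ B ↔ ω' ∈ B)) → ∀ x,
      ℙP x (A ∩ B) = ∫⁻ ω, B.indicator (fun ω => ℙP (ω n) A) ω ∂(ℙP x) := by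
  have hmA : Measurable (fun y => ℙP y A) := (Measure.measurable_coe hA).comp (chain_measurable hℙ)
  have hpA : ∀ x, consTraj x ⁻¹' A = A := fun x => by ext ω; exact hinv x ω
  have hp := hℙ.1
  induction n with
  | zero =>
    intro B hB hdep x
    rw [chain_rec hℙ x (hA.inter hB),
      chain_lintegral hℙ x (f := B.indicator (fun ω => ℙP (ω 0) A))
        ((hmA.comp (measurable_pi_apply 0)).indicator hB)]
    simp_rw [preimage_inter, hpA]
    by_cases h : ∃ ω, consTraj x ω ∈ B
    · obtain ⟨ω₀, h0⟩ := h
      have hall : ∀ ω, consTraj x ω ∈ B := fun ω =>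
        (hdep (consTraj x ω₀) (consTraj x ω) (by
          intro i hi
          obtain rfl : i = 0 := by omega
          rfl)).1 h0
      have h1 : consTraj x ⁻¹' B = univ := by ext ω; simp [hall]
      simp only [h1, inter_univ, Set.indicator_of_mem (hall _)]
      have h2 := chain_rec hℙ x hA
      simp only [hpA] at h2
      rw [← h2]
      simp [consTraj]
    · push Not at h
      have h1 : consTraj x ⁻¹' B = ∅ := by ext ω; simp [h]
      simp [h1, Set.indicator_of_notMem (h _)]
  | succ n ih =>
    intro B hB hdep x
    rw [chain_rec hℙ x (hA.inter hB),
      chain_lintegral hℙ x (f := B.indicator (fun ω => ℙP (ω (n + 1)) A))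
        ((hmA.comp (measurable_pi_apply (n + 1))).indicator hB)]
    simp_rw [preimage_inter, hpA]
    congr 1
    funext y
    rw [ih _ (measurable_consTraj_aux x hB) ?_ y]
    · rfl
    · intro ω ω' h
      refine hdep _ _ ?_
      intro i hi
      cases i with
      | zero => rfl
      | succ i => exact h i (by omega)

lemma map_shift_chain {P : Kernel E E} {ℙP : E → Measure (ℕ → E)}
    (hℙ : IsChainLaw P ℙP) {μ : Measure E} (hμ : IsInvariantMeasure P μ) :
    MeasurePreserving shiftTraj (μ.bind ℙP) (μ.bind ℙP) := by
  have hm := chain_measurable hℙ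
  refine ⟨measurable_shiftTraj, ?_⟩
  have hinv : μ.bind P = μ := by
    ext s hs
    rw [Measure.bind_apply hs P.aemeasurable, hμ s hs]
  ext B hB
  rw [Measure.map_apply measurable_shiftTraj hB,
    Measure.bind_apply (measurable_shiftTraj hB) hm.aemeasurable]
  have : ∀ x, ℙP x (shiftTraj ⁻¹' B) = ∫⁻ y, ℙP y B ∂(P x) := fun x => by
    rw [chain_rec hℙ x (measurable_shiftTraj hB)]
    rfl
  simp_rw [this]
  rw [← Measure.lintegral_bind (f := fun y => ℙP y B) P.aemeasurable
    ((Measure.measurable_coe hB).comp hm).aemeasurable, hinv, Measure.bind_apply hB hm.aemeasurable]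

lemma map_eval_chain {P : Kernel E E} [IsMarkovKernel P] {ℙP : E → Measure (ℕ → E)}
    (hℙ : IsChainLaw P ℙP) {μ : Measure E} (hμ : IsInvariantMeasure P μ) (n : ℕ) :
    (μ.bind ℙP).map (fun ω => ω n) = μ := by
  have hm := chain_measurable hℙ
  have hp := hℙ.1
  induction n with
  | zero =>
    ext s hs
    have h0 : MeasurableSet ((fun ω : ℕ → E => ω 0) ⁻¹' s) := measurable_pi_apply 0 hs
    rw [Measure.map_apply (measurable_pi_apply 0) hs, Measure.bind_apply h0 hm.aemeasurable]
    have : ∀ x, ℙP x ((fun ω : ℕ → E => ω 0) ⁻¹' s) = s.indicator 1 x := fun x => by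
      rw [chain_rec hℙ x h0]
      by_cases hx : x ∈ s
      · have : consTraj x ⁻¹' ((fun ω : ℕ → E => ω 0) ⁻¹' s) = univ := by
          ext ω; simp [consTraj, hx]
        simp [this, hx]
      · have : consTraj x ⁻¹' ((fun ω : ℕ → E => ω 0) ⁻¹' s) = ∅ := by
          ext ω; simp [consTraj, hx]
        simp [this, hx]
    simp_rw [this]
    simp [lintegral_indicator_one hs]
  | succ n ih =>
    have h := (map_shift_chain hℙ hμ).map_eq
    conv_rhs => rw [← ih, ← h]
    rw [Measure.map_map (measurable_pi_apply n) measurable_shiftTraj]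
    rfl

lemma zero_one_chain {P : Kernel E E} [IsMarkovKernel P] {ℙP : E → Measure (ℕ → E)}
    (hℙ : IsChainLaw P ℙP) {μ : Measure E} [IsProbabilityMeasure μ]
    (hμ : IsInvariantMeasure P μ) {A : Set (ℕ → E)} (hA : MeasurableSet A)
    (hinv : ∀ x ω, consTraj x ω ∈ A ↔ ω ∈ A) :
    ∀ᵐ x ∂μ, ℙP x A = 0 ∨ ℙP x Aᶜ = 0 := by
  have hm := chain_measurable hℙ
  have hp := hℙ.1
  set Q := μ.bind ℙP with hQ
  have hQf : IsProbabilityMeasure Q := by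
    constructor
    rw [hQ, Measure.bind_apply MeasurableSet.univ hm.aemeasurable]
    simp
  have hmA : Measurable (fun y => ℙP y A) := (Measure.measurable_coe hA).comp hm
  have hmA' : Measurable (fun y => ℙP y Aᶜ) := (Measure.measurable_coe hA.compl).comp hm
  have hle : ∀ ε : ENNReal, 0 < ε → ∫⁻ x, ℙP x A * ℙP x Aᶜ ∂μ ≤ ε := by
    intro ε hε
    obtain ⟨B, hBc, hBε⟩ := exists_measure_symmDiff_lt_of_generateFrom_isSetRing (μ := Q)
      (isSetAlgebra_measurableCylinders (α := fun _ : ℕ => E)).isSetRing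
      ⟨{univ}, by simp, by
        rw [singleton_subset_iff]
        exact (isSetAlgebra_measurableCylinders (α := fun _ : ℕ => E)).univ_mem, by simp⟩
      generateFrom_measurableCylinders.symm hA hε
    rw [mem_measurableCylinders] at hBc
    obtain ⟨s, S, hS, rfl⟩ := hBc
    have hB : MeasurableSet (cylinder (α := fun _ : ℕ => E) s S) :=
      MeasurableSet.cylinder (α := fun _ : ℕ => E) s hS
    set B := cylinder (α := fun _ : ℕ => E) s S with hBdef
    set n := s.sup id with hn
    have hdep : ∀ ω ω' : ℕ → E, (∀ i ≤ n, ω i = ω' i) → (ω ∈ B ↔ ω' ∈ B) := by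
      intro ω ω' h
      have : s.restrict ω = s.restrict ω' := by
        funext i
        exact h i (Finset.le_sup (f := id) i.2)
      rw [hBdef, mem_cylinder, mem_cylinder, this]
    have e1 : Q (Aᶜ ∩ B) = ∫⁻ ω, B.indicator (fun ω => ℙP (ω n) Aᶜ) ω ∂Q := by
      rw [hQ, Measure.bind_apply (hA.compl.inter hB) hm.aemeasurable,
        Measure.lintegral_bind (f := B.indicator (fun ω => ℙP (ω n) Aᶜ)) hm.aemeasurable
          ((hmA'.comp (measurable_pi_apply n)).indicator hB).aemeasurable]
      exact lintegral_congr fun x => chain_markov hℙ hA.compl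
        (fun x ω => not_congr (hinv x ω)) n B hB hdep x
    have e2 : Q (A ∩ Bᶜ) = ∫⁻ ω, Bᶜ.indicator (fun ω => ℙP (ω n) A) ω ∂Q := by
      rw [hQ, Measure.bind_apply (hA.inter hB.compl) hm.aemeasurable,
        Measure.lintegral_bind (f := Bᶜ.indicator (fun ω => ℙP (ω n) A)) hm.aemeasurable
          ((hmA.comp (measurable_pi_apply n)).indicator hB.compl).aemeasurable]
      exact lintegral_congr fun x => chain_markov hℙ hA
        hinv n Bᶜ hB.compl (fun ω ω' h => not_congr (hdep ω ω' h)) x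
    calc ∫⁻ x, ℙP x A * ℙP x Aᶜ ∂μ
        = ∫⁻ ω, ℙP (ω n) A * ℙP (ω n) Aᶜ ∂Q := by
          conv_lhs => rw [← map_eval_chain hℙ hμ n]
          rw [lintegral_map (f := fun x => ℙP x A * ℙP x Aᶜ) (hmA.mul hmA') (measurable_pi_apply n)]
      _ ≤ ∫⁻ ω, (B.indicator (fun ω => ℙP (ω n) Aᶜ) ω + Bᶜ.indicator (fun ω => ℙP (ω n) A) ω) ∂Q := by
          refine lintegral_mono fun ω => ?_
          by_cases h : ω ∈ B
          · simp only [Set.indicator_of_mem h]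
            refine le_trans ?_ le_self_add
            exact mul_le_of_le_one_left zero_le prob_le_one
          · have h' : ω ∈ Bᶜ := h
            simp only [Set.indicator_of_mem h']
            refine le_trans ?_ le_add_self
            exact mul_le_of_le_one_right zero_le prob_le_one
      _ = Q (Aᶜ ∩ B) + Q (A ∩ Bᶜ) := by
          rw [lintegral_add_left (f := B.indicator (fun ω => ℙP (ω n) Aᶜ)) ((hmA'.comp (measurable_pi_apply n)).indicator hB), e1, e2]
      _ = Q (symmDiff B A) := by
          rw [Set.symmDiff_def, measure_union (disjoint_sdiff_sdiff) (MeasurableSet.diff hA hB),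
            Set.sdiff_eq, Set.sdiff_eq, inter_comm B]
      _ ≤ ε := hBε.le
  have h0 : ∫⁻ x, ℙP x A * ℙP x Aᶜ ∂μ = 0 :=
    le_antisymm (le_of_forall_pos_le_add fun ε hε => by simpa using hle ε hε) zero_le
  have h0 := (lintegral_eq_zero_iff (hmA.mul hmA')).1 h0
  filter_upwards [h0] with x hx
  simpa using hx

end Helpers

section Maximal

open Set

/-- partial maxima used in the maximal ergodic inequality -/
def garsiaMax {Ω : Type*} (T : Ω → Ω) (f : Ω → ℝ) : ℕ → Ω → ℝ
  | 0 => fun _ => 0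
  | n + 1 => fun ω => max 0 (f ω + garsiaMax T f n (T ω))

lemma garsiaMax_mono {Ω : Type*} (T : Ω → Ω) (f : Ω → ℝ) (n : ℕ) :
    ∀ ω, garsiaMax T f n ω ≤ garsiaMax T f (n + 1) ω := by
  induction n with
  | zero => intro ω; simp [garsiaMax]
  | succ n ih =>
    intro ω
    have := ih (T ω)
    simp only [garsiaMax] at this ⊢
    exact max_le_max le_rfl (by linarith)

lemma garsiaMax_nonneg {Ω : Type*} (T : Ω → Ω) (f : Ω → ℝ) (n : ℕ) (ω : Ω) :
    0 ≤ garsiaMax T f n ω := by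
  cases n with
  | zero => simp [garsiaMax]
  | succ n => simp [garsiaMax]

variable {Ω : Type*} [MeasurableSpace Ω] {Q : Measure Ω} {T : Ω → Ω}

lemma garsiaMax_measurable (hT : Measurable T) {f : Ω → ℝ} (hf : Measurable f) (n : ℕ) :
    Measurable (garsiaMax T f n) := by
  induction n with
  | zero => exact measurable_const
  | succ n ih => exact measurable_const.max (hf.add (ih.comp hT))

lemma garsiaMax_integrable (hT : MeasurePreserving T Q Q) {f : Ω → ℝ} (hf : Integrable f Q)
    (n : ℕ) : Integrable (garsiaMax T f n) Q := by
  induction n with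
  | zero => exact integrable_zero _ _ _
  | succ n ih =>
    exact (integrable_zero Ω ℝ Q).sup (hf.add (hT.integrable_comp_of_integrable ih))

lemma maximal_ergodic (hT : MeasurePreserving T Q Q) {f : Ω → ℝ} (hfm : Measurable f)
    (hf : Integrable f Q) (n : ℕ) :
    0 ≤ ∫ ω in {ω | 0 < garsiaMax T f n ω}, f ω ∂Q := by
  have hS : MeasurableSet {ω | 0 < garsiaMax T f n ω} :=
    measurableSet_lt measurable_const (garsiaMax_measurable hT.measurable hfm n)
  have hi := garsiaMax_integrable hT hf n
  have hiT : Integrable (fun ω => garsiaMax T f n (T ω)) Q := hT.integrable_comp_of_integrable hi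
  rw [← integral_indicator hS]
  have h1 : ∫ ω, garsiaMax T f n (T ω) ∂Q = ∫ ω, garsiaMax T f n ω ∂Q := by
    conv_rhs => rw [← hT.map_eq]
    rw [integral_map hT.measurable.aemeasurable]
    exact (garsiaMax_measurable hT.measurable hfm n).aestronglyMeasurable
  have h2 : ∫ ω, (garsiaMax T f n ω - garsiaMax T f n (T ω)) ∂Q = 0 := by
    rw [integral_sub hi hiT, h1, sub_self]
  refine h2.ge.trans ?_
  refine integral_mono (hi.sub hiT) (hf.indicator hS) fun ω => ?_
  simp only
  by_cases h : 0 < garsiaMax T f n ω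
  · rw [indicator_of_mem (show ω ∈ {ω | 0 < garsiaMax T f n ω} from h)]
    have h3 := garsiaMax_mono T f n ω
    have h4 : 0 < garsiaMax T f (n + 1) ω := lt_of_lt_of_le h h3
    simp only [garsiaMax] at h3 h4
    rcases max_cases 0 (f ω + garsiaMax T f n (T ω)) with h5 | h5 <;> linarith
  · rw [indicator_of_notMem (show ω ∉ {ω | 0 < garsiaMax T f n ω} from h)]
    have := garsiaMax_nonneg T f n (T ω)
    linarith

end Maximal

section Bad

open Set

variable {E : Type*} [MeasurableSpace E]

/-- number of visits to `D` up to time `n` -/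
noncomputable def visits (D : Set E) (n : ℕ) (ω : ℕ → E) : ℝ :=
  ∑ i ∈ Finset.range n, D.indicator (fun _ => (1 : ℝ)) (ω i)

/-- trajectories which visit `D` with excessive frequency -/
def badSet (D : Set E) (a : ℝ) : Set (ℕ → E) :=
  {ω | ∀ C : ℕ, ∃ n : ℕ, a * n + C ≤ visits D n ω}

lemma visits_measurable {D : Set E} (hD : MeasurableSet D) (n : ℕ) : Measurable (visits D n) := by
  refine Finset.measurable_sum _ fun i _ => ?_
  exact (measurable_const.indicator hD).comp (measurable_pi_apply i)

lemma badSet_measurable {D : Set E} (hD : MeasurableSet D) (a : ℝ) :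
    MeasurableSet (badSet D a) := by
  have : badSet D a = ⋂ C : ℕ, ⋃ n : ℕ, {ω | a * n + C ≤ visits D n ω} := by
    ext ω; simp [badSet]
  rw [this]
  exact MeasurableSet.iInter fun C => MeasurableSet.iUnion fun n =>
    measurableSet_le measurable_const (visits_measurable hD n)

lemma visits_succ_shift (D : Set E) (n : ℕ) (ω : ℕ → E) :
    visits D (n + 1) ω = visits D n (shiftTraj ω) + D.indicator (fun _ => (1 : ℝ)) (ω 0) := by
  simp only [visits, shiftTraj]
  rw [Finset.sum_range_succ']

lemma ind_nonneg (D : Set E) (x : E) : 0 ≤ D.indicator (fun _ => (1 : ℝ)) x :=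
  indicator_nonneg (fun _ _ => zero_le_one) x

lemma ind_le_one (D : Set E) (x : E) : D.indicator (fun _ => (1 : ℝ)) x ≤ 1 :=
  indicator_le_self' (s := D) (f := fun _ => (1 : ℝ)) (fun _ _ => zero_le_one) x

lemma badSet_inv (D : Set E) {a : ℝ} (ha : 0 < a) (ha1 : a ≤ 1) (x : E) (ω : ℕ → E) :
    consTraj x ω ∈ badSet D a ↔ ω ∈ badSet D a := by
  have hs : shiftTraj (consTraj x ω) = ω := rfl
  constructor
  · intro h C
    obtain ⟨n, hn⟩ := h (C + 1)
    cases n with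
    | zero =>
      simp [visits] at hn
      exfalso
      have : (0 : ℝ) ≤ C := Nat.cast_nonneg C
      linarith
    | succ n =>
      refine ⟨n, ?_⟩
      rw [visits_succ_shift, hs] at hn
      have := ind_le_one D (consTraj x ω 0)
      push_cast at hn
      nlinarith
  · intro h C
    obtain ⟨n, hn⟩ := h (C + 1)
    refine ⟨n + 1, ?_⟩
    rw [visits_succ_shift, hs]
    have := ind_nonneg D (consTraj x ω 0)
    push_cast at hn ⊢
    nlinarith

lemma visits_le_garsia (D : Set E) (a : ℝ) (n : ℕ) : ∀ ω,
    visits D n ω - a * n ≤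
      garsiaMax shiftTraj (fun ω => D.indicator (fun _ => (1 : ℝ)) (ω 0) - a) n ω := by
  induction n with
  | zero => intro ω; simp [visits, garsiaMax]
  | succ n ih =>
    intro ω
    have := ih (shiftTraj ω)
    rw [visits_succ_shift]
    simp only [garsiaMax]
    refine le_trans ?_ (le_max_right _ _)
    push_cast
    linarith

lemma badSet_measure {P : Kernel E E} [IsMarkovKernel P] {ℙP : E → Measure (ℕ → E)}
    (hℙ : IsChainLaw P ℙP) {μ : Measure E} [IsProbabilityMeasure μ]
    (hμ : IsInvariantMeasure P μ) {D : Set E} (hD : MeasurableSet D) {a : ℝ} (ha : 0 < a) :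
    ENNReal.ofReal a * (μ.bind ℙP) (badSet D a) ≤ μ D := by
  have hm := chain_measurable hℙ
  have hp := hℙ.1
  set Q := μ.bind ℙP with hQ
  have hQf : IsProbabilityMeasure Q := by
    constructor
    rw [hQ, Measure.bind_apply MeasurableSet.univ hm.aemeasurable]
    simp
  have hT := map_shift_chain hℙ hμ
  rw [← hQ] at hT
  set g : (ℕ → E) → ℝ := fun ω => D.indicator (fun _ => (1 : ℝ)) (ω 0) with hg
  set f : (ℕ → E) → ℝ := fun ω => D.indicator (fun _ => (1 : ℝ)) (ω 0) - a with hf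
  have hgm : Measurable g := (measurable_const.indicator hD).comp (measurable_pi_apply 0)
  have hfm : Measurable f := hgm.sub_const a
  have hgi : Integrable g Q := Integrable.of_bound hgm.aestronglyMeasurable 1
    (ae_of_all _ fun ω => by
      rw [Real.norm_of_nonneg (ind_nonneg D _)]; exact ind_le_one D _)
  have hfi : Integrable f Q := hgi.sub (integrable_const a)
  have hgint : ∫ ω, g ω ∂Q = μ.real D := by
    have h0 : g = ((fun ω : ℕ → E => ω 0) ⁻¹' D).indicator (fun _ => (1 : ℝ)) := rfl
    rw [h0, integral_indicator (measurable_pi_apply 0 hD)]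
    simp only [integral_const, smul_eq_mul, mul_one, measureReal_restrict_apply_univ]
    rw [← map_eval_chain hℙ hμ 0, map_measureReal_apply (measurable_pi_apply 0) hD]
  set G : ℕ → Set (ℕ → E) := fun n => {ω | 0 < garsiaMax shiftTraj f n ω} with hG
  have hGm : ∀ n, MeasurableSet (G n) := fun n =>
    measurableSet_lt measurable_const (garsiaMax_measurable hT.measurable hfm n)
  have hGle : ∀ n, ENNReal.ofReal a * Q (G n) ≤ μ D := by
    intro n
    have h1 := maximal_ergodic hT hfm hfi n
    have h2 : ∫ ω in G n, f ω ∂Q = ∫ ω in G n, g ω ∂Q - a * Q.real (G n) := by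
      have : f = fun ω => g ω - a := rfl
      rw [this, integral_sub hgi.integrableOn (integrable_const a)]
      simp [mul_comm]
    have h3 : ∫ ω in G n, g ω ∂Q ≤ ∫ ω, g ω ∂Q :=
      setIntegral_le_integral hgi (ae_of_all _ fun ω => ind_nonneg D _)
    have h4 : a * Q.real (G n) ≤ μ.real D := by
      rw [← hgint]
      change 0 ≤ ∫ ω in G n, f ω ∂Q at h1
      linarith
    have h5 := ENNReal.ofReal_le_ofReal h4
    rwa [ENNReal.ofReal_mul ha.le, ofReal_measureReal, ofReal_measureReal] at h5
  have hsub : badSet D a ⊆ ⋃ n, G n := by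
    intro ω h
    obtain ⟨n, hn⟩ := h 1
    have := visits_le_garsia D a n ω
    refine mem_iUnion.2 ⟨n, ?_⟩
    change 0 < garsiaMax shiftTraj f n ω
    push_cast at hn
    linarith
  have hmono : Monotone G := monotone_nat_of_le_succ fun n ω h =>
    lt_of_lt_of_le h (garsiaMax_mono shiftTraj f n ω)
  calc ENNReal.ofReal a * Q (badSet D a) ≤ ENNReal.ofReal a * Q (⋃ n, G n) := by
        gcongr
    _ = ⨆ n, ENNReal.ofReal a * Q (G n) := by
        rw [hmono.measure_iUnion, ENNReal.mul_iSup]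
    _ ≤ μ D := iSup_le hGle

lemma key_chain {P : Kernel E E} [IsMarkovKernel P] {ℙP : E → Measure (ℕ → E)}
    (hℙ : IsChainLaw P ℙP) {μ : Measure E} [IsProbabilityMeasure μ]
    (hμ : IsInvariantMeasure P μ) (D : ℕ → Set E) (hD : ∀ m, MeasurableSet (D m))
    (hlim : Tendsto (fun m => μ (D m)) atTop (nhds 0)) :
    ∀ᵐ x ∂μ, ∀ k : ℕ, ∃ m, ℙP x (badSet (D m) (1 / ((k : ℝ) + 1))) = 0 := by
  have hm := chain_measurable hℙ
  have hp := hℙ.1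
  rw [ae_all_iff]
  intro k
  set a : ℝ := 1 / ((k : ℝ) + 1) with ha
  have hk : (0 : ℝ) < (k : ℝ) + 1 := by positivity
  have ha0 : 0 < a := by positivity
  have ha1 : a ≤ 1 := by
    rw [ha, div_le_one hk]
    have : (0 : ℝ) ≤ k := Nat.cast_nonneg k
    linarith
  set N : Set E := {x | ∀ m, ℙP x (badSet (D m) a) ≠ 0} with hN
  have hz : ∀ᵐ x ∂μ, ∀ m, ℙP x (badSet (D m) a) = 0 ∨ ℙP x (badSet (D m) a)ᶜ = 0 :=
    ae_all_iff.2 fun m => zero_one_chain hℙ hμ (badSet_measurable (hD m) a)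
      (badSet_inv (D m) ha0 ha1)
  have hle : ∀ m, ENNReal.ofReal a * μ N ≤ μ (D m) := by
    intro m
    refine le_trans ?_ (badSet_measure hℙ hμ (hD m) ha0)
    gcongr
    have hb := badSet_measurable (hD m) a
    rw [Measure.bind_apply hb hm.aemeasurable]
    have h1 : μ N ≤ μ {x | 1 ≤ ℙP x (badSet (D m) a)} := by
      refine measure_mono_ae ?_
      filter_upwards [hz] with x hx hxN
      have h2 := (hx m).resolve_left (hxN m)
      exact ((prob_compl_eq_zero_iff hb).1 h2).ge
    refine h1.trans ?_
    have := mul_meas_ge_le_lintegral (μ := μ) ((Measure.measurable_coe hb).comp hm) 1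
    simpa using this
  have h0 : ENNReal.ofReal a * μ N = 0 :=
    le_antisymm (ge_of_tendsto' hlim hle) zero_le
  have h0' : μ N = 0 := by
    rcases mul_eq_zero.1 h0 with h | h
    · rw [ENNReal.ofReal_eq_zero] at h
      linarith
    · exact h
  rw [ae_iff]
  convert h0' using 2
  ext x
  simp [hN]

lemma exists_compacts {E : Type*} [TopologicalSpace E] [PolishSpace E]
    [MeasurableSpace E] [BorelSpace E] (μ : Measure E) [IsProbabilityMeasure μ]
    {C : Set E} (hC : MeasurableSet C) (h : μ Cᶜ = 0) :
    ∃ K : ℕ → Set E, (∀ m, K m ⊆ C) ∧ (∀ m, IsCompact (K m)) ∧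
      Tendsto (fun m => μ (K m)ᶜ) atTop (nhds 0) := by
  have : ∀ m : ℕ, ∃ K, K ⊆ C ∧ IsCompact K ∧ μ (C \ K) < ((m : ENNReal) + 1)⁻¹ := fun m =>
    hC.exists_isCompact_sdiff_lt (measure_ne_top _ _) (by simp)
  choose K h1 h2 h3 using this
  refine ⟨K, h1, h2, ?_⟩
  have h4 : ∀ m, μ (K m)ᶜ ≤ ((m : ENNReal) + 1)⁻¹ := fun m => by
    calc μ (K m)ᶜ ≤ μ (C \ K m ∪ Cᶜ) := measure_mono (by
          intro x hx
          by_cases hxC : x ∈ C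
          · exact Or.inl ⟨hxC, hx⟩
          · exact Or.inr hxC)
      _ ≤ μ (C \ K m) + μ Cᶜ := measure_union_le _ _
      _ ≤ _ := by rw [h, add_zero]; exact (h3 m).le
  have h5 : Tendsto (fun m : ℕ => ((m : ENNReal) + 1)⁻¹) atTop (nhds 0) := by
    have := (tendsto_add_atTop_iff_nat 1).2 ENNReal.tendsto_inv_nat_nhds_zero
    simpa using this
  exact tendsto_of_tendsto_of_tendsto_of_le_of_le tendsto_const_nhds h5 (fun _ => zero_le) h4

lemma limsup_lt_aux (K₁ K₂ : Set E) (R : E → E → Prop) [∀ x y, Decidable (R x y)]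
    (hR : ∀ x ∈ K₁, ∀ y ∈ K₂, ¬ R x y) {a α : ℝ} (hα : 2 * a < α) (ω η : ℕ → E)
    (hω : ω ∉ badSet K₁ᶜ a) (hη : η ∉ badSet K₂ᶜ a) :
    ¬ α ≤ limsup (fun n : ℕ => (∑ i ∈ Finset.range n,
            if R (ω i) (η i) then (1 : ℝ) else 0) / n) atTop := by
  simp only [badSet, mem_ofPred_eq, not_forall, not_exists, not_le] at hω hη
  obtain ⟨C₁, h1⟩ := hω
  obtain ⟨C₂, h2⟩ := hη
  rw [not_le]
  refine lt_of_le_of_lt ?_ hα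
  have hlim : Tendsto (fun n : ℕ => 2 * a + ((C₁ : ℝ) + C₂) / n) atTop (nhds (2 * a)) := by
    simpa using (tendsto_const_div_atTop_nhds_zero_nat ((C₁ : ℝ) + C₂)).const_add (2 * a)
  rw [← hlim.limsup_eq]
  refine limsup_le_limsup ?_ ?_ hlim.isBoundedUnder_le
  · filter_upwards [eventually_gt_atTop 0] with n hn
    have hn' : (0 : ℝ) < n := by exact_mod_cast hn
    rw [div_le_iff₀ hn', add_mul, div_mul_cancel₀ _ hn'.ne']
    have h3 : (∑ i ∈ Finset.range n, if R (ω i) (η i) then (1 : ℝ) else 0) ≤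
        visits K₁ᶜ n ω + visits K₂ᶜ n η := by
      simp only [visits]
      rw [← Finset.sum_add_distrib]
      refine Finset.sum_le_sum fun i _ => ?_
      have i1 := ind_nonneg K₁ᶜ (ω i)
      have i2 := ind_nonneg K₂ᶜ (η i)
      split_ifs with h
      · by_cases hx : ω i ∈ K₁
        · have hy : η i ∈ K₂ᶜ := fun hy => hR _ hx _ hy h
          rw [indicator_of_mem hy]
          linarith
        · rw [indicator_of_mem (show ω i ∈ K₁ᶜ from hx)]
          linarith
      · linarith
    have := h1 n
    have := h2 n
    linarith
  · refine IsBoundedUnder.isCoboundedUnder_le ⟨0, ?_⟩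
    simp only [eventually_map]
    refine Eventually.of_forall fun n => ?_
    refine div_nonneg (Finset.sum_nonneg fun i _ => ?_) (Nat.cast_nonneg n)
    split_ifs <;> norm_num

end Bad

/-- Theorem `main`, Polish case: on a Polish space, with a lower semicontinuous
positive definite function `ρ : E × E → [0,∞)` in place of the metric, the
generalized-coupling condition implies that the invariant probability measures
`μ₁` and `μ₂` cannot be mutually singular. -/
theorem invariant_measures_not_singular_of_generalized_couplings_polish
    {E : Type*} [TopologicalSpace E] [PolishSpace E]
    [MeasurableSpace E] [BorelSpace E]
    (P : Kernel E E) [IsMarkovKernel P]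
    (μ₁ μ₂ : Measure E) [IsProbabilityMeasure μ₁] [IsProbabilityMeasure μ₂]
    (h₁ : IsInvariantMeasure P μ₁) (h₂ : IsInvariantMeasure P μ₂)
    (ℙP : E → Measure (ℕ → E)) (hℙ : IsChainLaw P ℙP)
    (ρ : E → E → ℝ) (hρlsc : LowerSemicontinuous (fun p : E × E => ρ p.1 p.2))
    (hρnonneg : ∀ x y, 0 ≤ ρ x y) (hρposdef : ∀ x y, ρ x y = 0 ↔ x = y)
    (M : Set (E × E)) (hM : MeasurableSet M) (hMpos : 0 < (μ₁.prod μ₂) M)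
    (hcoup : ∀ x y : E, (x, y) ∈ M → ∃ α > (0 : ℝ), ∀ ε > (0 : ℝ),
      ∃ ξ : Measure ((ℕ → E) × (ℕ → E)), IsGeneralizedCoupling ξ (ℙP x) (ℙP y) ∧
        0 < ξ {p : (ℕ → E) × (ℕ → E) | α ≤ limsup (fun n : ℕ =>
          (∑ i ∈ Finset.range n,
            if ρ (p.1 i) (p.2 i) ≤ ε then (1 : ℝ) else 0) / n) atTop}) :
    ¬ ∃ C : Set E, MeasurableSet C ∧ μ₁ C = 1 ∧ μ₂ C = 0 := by
  rintro ⟨C, hC, hC1, hC2⟩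
  have hC1' : μ₁ Cᶜ = 0 := (prob_compl_eq_zero_iff hC).2 hC1
  obtain ⟨K₁, hK₁C, hK₁, hK₁l⟩ := exists_compacts μ₁ hC hC1'
  obtain ⟨K₂, hK₂C, hK₂, hK₂l⟩ := exists_compacts μ₂ hC.compl (by simpa using hC2)
  have g1 := key_chain hℙ h₁ (fun m => (K₁ m)ᶜ) (fun m => (hK₁ m).measurableSet.compl) hK₁l
  have g2 := key_chain hℙ h₂ (fun m => (K₂ m)ᶜ) (fun m => (hK₂ m).measurableSet.compl) hK₂l
  have g1' := Measure.quasiMeasurePreserving_fst (μ := μ₁) (ν := μ₂) |>.ae g1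
  have g2' := Measure.quasiMeasurePreserving_snd (μ := μ₁) (ν := μ₂) |>.ae g2
  have hfr : ∃ᵐ p ∂(μ₁.prod μ₂), p ∈ M := by
    rw [frequently_ae_mem_iff]
    exact hMpos.ne'
  obtain ⟨⟨x, y⟩, hxyM, hx, hy⟩ := (hfr.and_eventually (g1'.and g2')).exists
  obtain ⟨α, hα, hcoup'⟩ := hcoup x y hxyM
  obtain ⟨k, hk⟩ := exists_nat_one_div_lt (half_pos hα)
  obtain ⟨m₁, hm₁⟩ := hx k
  obtain ⟨m₂, hm₂⟩ := hy k
  have hε : ∃ ε > (0 : ℝ), ∀ u ∈ K₁ m₁, ∀ v ∈ K₂ m₂, ¬ ρ u v ≤ ε := by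
    rcases (K₁ m₁ ×ˢ K₂ m₂).eq_empty_or_nonempty with he | hne
    · refine ⟨1, one_pos, fun u hu v hv => ?_⟩
      have : (u, v) ∈ K₁ m₁ ×ˢ K₂ m₂ := ⟨hu, hv⟩
      rw [he] at this
      exact this.elim
    · obtain ⟨⟨u₀, v₀⟩, ⟨hu₀, hv₀⟩, hmin⟩ := LowerSemicontinuousOn.exists_isMinOn hne
        ((hK₁ m₁).prod (hK₂ m₂)) (hρlsc.lowerSemicontinuousOn _)
      have hpos : 0 < ρ u₀ v₀ := by
        refine lt_of_le_of_ne (hρnonneg _ _) fun h => ?_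
        have huv := (hρposdef u₀ v₀).1 h.symm
        exact hK₂C m₂ hv₀ (huv ▸ hK₁C m₁ hu₀)
      refine ⟨ρ u₀ v₀ / 2, half_pos hpos, fun u hu v hv => ?_⟩
      have : ρ u₀ v₀ ≤ ρ u v := hmin (show (u, v) ∈ K₁ m₁ ×ˢ K₂ m₂ from ⟨hu, hv⟩)
      linarith
  obtain ⟨ε, hε0, hεK⟩ := hε
  obtain ⟨ξ, ⟨_, hξ1, hξ2⟩, hξpos⟩ := hcoup' ε hε0
  have z1 := hξ1 hm₁
  have z2 := hξ2 hm₂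
  rw [Measure.map_apply measurable_fst
    (badSet_measurable (hK₁ m₁).measurableSet.compl _)] at z1
  rw [Measure.map_apply measurable_snd
    (badSet_measurable (hK₂ m₂).measurableSet.compl _)] at z2
  refine hξpos.ne' (measure_mono_null ?_ (measure_union_null z1 z2))
  rintro ⟨ω, η⟩ hp
  by_contra hcon
  simp only [Set.mem_union, Set.mem_preimage, not_or] at hcon
  exact limsup_lt_aux (K₁ m₁) (K₂ m₂) (fun u v => ρ u v ≤ ε) hεK
    (a := 1 / ((k : ℝ) + 1)) (by linarith) ω η hcon.1 hcon.2 hp
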